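/- Let R be a commutative ring and let (B•, d) be a cochain complex of R-modules. Let θ be a family of R-linear maps θ : Bⁿ → Bⁿ⁺¹ (for all n) satisfying θ∘θ = 0 and d∘θ = −θ∘d, and assume that the complex (B•, θ) is exact, i.e. ker(θ : Bⁿ → Bⁿ⁺¹) = im(θ : Bⁿ⁻¹ → Bⁿ) for every n. Let (A•, d̄) be the cochain complex with Aⁿ = coker(θ : Bⁿ⁻¹ → Bⁿ) and the differential induced by d. Define the completed Hirsch extension B̂• to be the cochain complex with B̂ⁿ = ∏_{i ∈ ℕ} Bⁿ and differential (bᵢ)_{i∈ℕ} ↦ (d bᵢ + θ(b_{i+1}))_{i∈ℕ}. Then the augmentation B̂• → A• sending (bᵢ)_{i∈ℕ} to the class of b₀ is a chain map and a quasi-isomorphism (it induces isomorphisms on all cohomology modules). -/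

import Mathlib

/-
Setting: a cochain complex `(B•, d)` of `R`-modules, indexed by `ℤ`.  The maps `d i j` and
`θ i j : B i →ₗ[R] B j` are declared for all pairs of indices and required to vanish unless
`j = i + 1` (the usual "shape" convention of homological complexes, which avoids dependent
type casts): `d` is the differential and `θ` is the square-zero degree-one map
anticommuting with `d`.

The completed Hirsch extension `B̂•` has `B̂ⁿ = ∏_{i ∈ ℕ} Bⁿ` with differential
`(bᵢ)ᵢ ↦ (d bᵢ + θ b_{i+1})ᵢ` (`hirschD`), the quotient complex `A•` has
`Aⁿ = coker (θ : Bⁿ⁻¹ → Bⁿ)` with the differential induced by `d`, and the augmentation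
`B̂ⁿ → Aⁿ` sends `(bᵢ)ᵢ` to the class of `b₀` (`hirschAug`).
-/

/-- The differential `(bᵢ)ᵢ ↦ (d bᵢ + θ(b_{i+1}))ᵢ` of the completed Hirsch extension
`B̂ⁿ = ∏_{i ∈ ℕ} Bⁿ`. -/
noncomputable def hirschD {R : Type*} [CommRing R] {B : ℤ → Type*}
    [∀ n, AddCommGroup (B n)] [∀ n, Module R (B n)]
    (d θ : ∀ i j : ℤ, B i →ₗ[R] B j) (i j : ℤ) :
    (ℕ → B i) →ₗ[R] (ℕ → B j) where
  toFun b := fun n => d i j (b n) + θ i j (b (n + 1))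
  map_add' x y := by
    funext n
    simp only [Pi.add_apply, map_add]
    abel
  map_smul' c x := by
    funext n
    simp only [Pi.smul_apply, map_smul, RingHom.id_apply, smul_add]

/-- The augmentation `B̂ⁿ = ∏_{i ∈ ℕ} Bⁿ → Aⁿ = Bⁿ / im(θ : Bⁿ⁻¹ → Bⁿ)`,
`(bᵢ)ᵢ ↦ [b₀]`. -/
noncomputable def hirschAug {R : Type*} [CommRing R] {B : ℤ → Type*}
    [∀ n, AddCommGroup (B n)] [∀ n, Module R (B n)]
    (θ : ∀ i j : ℤ, B i →ₗ[R] B j) (n : ℤ) :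
    (ℕ → B n) →ₗ[R] (B n ⧸ LinearMap.range (θ (n - 1) n)) :=
  (LinearMap.range (θ (n - 1) n)).mkQ.comp (LinearMap.proj 0)

theorem range_eq_ker_of_exact {R : Type*} [CommRing R] {B : ℤ → Type*}
    [∀ n, AddCommGroup (B n)] [∀ n, Module R (B n)] {θ : ∀ i j : ℤ, B i →ₗ[R] B j}
    (hexact : ∀ n : ℤ, LinearMap.ker (θ n (n + 1)) = LinearMap.range (θ (n - 1) n))
    {i j : ℤ} (hij : j = i + 1) :
    LinearMap.range (θ i j) = LinearMap.ker (θ j (j + 1)) := by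
  obtain rfl : i = j - 1 := by lia
  exact (hexact j).symm

/-- A cocycle of the completed Hirsch extension whose leading coefficient is `d x` modulo the
image of `θ` is the coboundary of a sequence starting with `x`. -/
theorem exists_hirschD_eq {R : Type*} [CommRing R] {B : ℤ → Type*}
    [∀ n, AddCommGroup (B n)] [∀ n, Module R (B n)] {d θ : ∀ i j : ℤ, B i →ₗ[R] B j}
    (hdd : ∀ i j k : ℤ, (d j k).comp (d i j) = 0)
    (hanti : ∀ i j k : ℤ, (d j k).comp (θ i j) = -((θ j k).comp (d i j)))
    (hexact : ∀ n : ℤ, LinearMap.ker (θ n (n + 1)) = LinearMap.range (θ (n - 1) n))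
    {i j : ℤ} (hij : j = i + 1) (b : ℕ → B j) (hb : hirschD d θ j (j + 1) b = 0)
    (x : B i) (hx : b 0 - d i j x ∈ LinearMap.range (θ i j)) :
    ∃ e : ℕ → B i, e 0 = x ∧ hirschD d θ i j e = b := by
  have hstep : ∀ (k : ℕ) (y : B i), ∃ z : B i, b k - d i j y ∈ LinearMap.range (θ i j) →
      θ i j z = b k - d i j y ∧ b (k + 1) - d i j z ∈ LinearMap.range (θ i j) := by
    intro k y
    by_cases hy : b k - d i j y ∈ LinearMap.range (θ i j)
    · obtain ⟨z, hz⟩ := hy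
      refine ⟨z, fun _ => ⟨hz, ?_⟩⟩
      rw [range_eq_ker_of_exact hexact hij, LinearMap.mem_ker, map_sub]
      have hbk : d j (j + 1) (b k) + θ j (j + 1) (b (k + 1)) = 0 := congrFun hb k
      have hdz : d j (j + 1) (θ i j z) = -θ j (j + 1) (d i j z) :=
        LinearMap.congr_fun (hanti i j (j + 1)) z
      have hdy : d j (j + 1) (d i j y) = 0 := LinearMap.congr_fun (hdd i j (j + 1)) y
      rw [hz, map_sub, hdy, sub_zero] at hdz
      rw [hdz] at hbk
      rw [← hbk]
      abel
    · exact ⟨0, fun h => absurd h hy⟩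
  choose next hnext using hstep
  let e : ℕ → B i := fun k => Nat.rec x next k
  have he : ∀ k, b k - d i j (e k) ∈ LinearMap.range (θ i j) := by
    intro k
    induction k with
    | zero => exact hx
    | succ k ih => exact (hnext k (e k) ih).2
  refine ⟨e, rfl, funext fun k => ?_⟩
  change d i j (e k) + θ i j (next k (e k)) = b k
  rw [(hnext k (e k) (he k)).1, add_sub_cancel]

/-- Let `(B•, d)` be a cochain complex of `R`-modules and `θ : Bⁿ → Bⁿ⁺¹`
a family of `R`-linear maps with `θ∘θ = 0` and `d∘θ = −θ∘d`, such that the complex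
`(B•, θ)` is exact.  Let `(A•, d̄)` be the cochain complex `Aⁿ = coker(θ : Bⁿ⁻¹ → Bⁿ)` with
the differential induced by `d`, and let `B̂•` be the completed Hirsch extension,
`B̂ⁿ = ∏_{i ∈ ℕ} Bⁿ` with differential `(bᵢ)ᵢ ↦ (d bᵢ + θ(b_{i+1}))ᵢ`.  Then the
augmentation `B̂• → A•`, `(bᵢ)ᵢ ↦ [b₀]`, is a chain map and a quasi-isomorphism: the
induced maps on cohomology are bijective (surjectivity and injectivity on cohomology
classes are spelled out elementwise below). -/
theorem hirsch_augmentation_quasiIso {R : Type*} [CommRing R] {B : ℤ → Type*}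
    [∀ n, AddCommGroup (B n)] [∀ n, Module R (B n)]
    (d θ : ∀ i j : ℤ, B i →ₗ[R] B j)
    (hd_shape : ∀ i j : ℤ, j ≠ i + 1 → d i j = 0)
    (hθ_shape : ∀ i j : ℤ, j ≠ i + 1 → θ i j = 0)
    (hdd : ∀ i j k : ℤ, (d j k).comp (d i j) = 0)
    (hθθ : ∀ i j k : ℤ, (θ j k).comp (θ i j) = 0)
    (hanti : ∀ i j k : ℤ, (d j k).comp (θ i j) = -((θ j k).comp (d i j)))
    (hexact : ∀ n : ℤ, LinearMap.ker (θ n (n + 1)) = LinearMap.range (θ (n - 1) n))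
    (dbar : ∀ i j : ℤ,
      (B i ⧸ LinearMap.range (θ (i - 1) i)) →ₗ[R] (B j ⧸ LinearMap.range (θ (j - 1) j)))
    (hdbar : ∀ i j : ℤ,
      (dbar i j).comp (LinearMap.range (θ (i - 1) i)).mkQ
        = ((LinearMap.range (θ (j - 1) j)).mkQ).comp (d i j)) :
    -- the augmentation is a chain map:
    (∀ i j : ℤ,
      (hirschAug θ j).comp (hirschD d θ i j) = (dbar i j).comp (hirschAug θ i)) ∧
    -- and a quasi-isomorphism: for every degree `n`,
    (∀ n : ℤ,
      -- the induced map on `n`-th cohomology is surjective: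
      (∀ a : B n ⧸ LinearMap.range (θ (n - 1) n), dbar n (n + 1) a = 0 →
        ∃ b : ℕ → B n, hirschD d θ n (n + 1) b = 0 ∧
          ∃ c : B (n - 1) ⧸ LinearMap.range (θ (n - 1 - 1) (n - 1)),
            hirschAug θ n b - a = dbar (n - 1) n c) ∧
      -- and injective:
      (∀ b : ℕ → B n, hirschD d θ n (n + 1) b = 0 →
        (∃ c : B (n - 1) ⧸ LinearMap.range (θ (n - 1 - 1) (n - 1)),
          hirschAug θ n b = dbar (n - 1) n c) →
        ∃ e : ℕ → B (n - 1), b = hirschD d θ (n - 1) n e)) := by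
  have hbar (i j : ℤ) (x : B i) :
      dbar i j (Submodule.Quotient.mk x) = Submodule.Quotient.mk (d i j x) :=
    LinearMap.congr_fun (hdbar i j) x
  refine ⟨fun i j => LinearMap.ext fun b => ?_, fun n => ⟨fun a ha => ?_, ?_⟩⟩
  · change Submodule.Quotient.mk (d i j (b 0) + θ i j (b 1)) =
      dbar i j (Submodule.Quotient.mk (b 0))
    rw [hbar, Submodule.Quotient.eq, add_sub_cancel_left]
    by_cases hij : j = i + 1
    · obtain rfl : i = j - 1 := by lia
      exact LinearMap.mem_range_self _ _
    · simp [hθ_shape i j hij]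
  · obtain ⟨x, rfl⟩ := Submodule.Quotient.mk_surjective _ a
    rw [hbar, Submodule.Quotient.mk_eq_zero, add_sub_cancel_right] at ha
    obtain ⟨b, rfl, hb⟩ := exists_hirschD_eq hdd hanti hexact rfl 0 (map_zero _) x
      (by simpa using ha)
    exact ⟨b, hb, 0, by rw [map_zero]; exact sub_self _⟩
  · rintro b hb ⟨c, hc⟩
    obtain ⟨x, rfl⟩ := Submodule.Quotient.mk_surjective _ c
    rw [hbar] at hc
    obtain ⟨e, -, he⟩ := exists_hirschD_eq hdd hanti hexact (sub_add_cancel n 1).symm b hb x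
      ((Submodule.Quotient.eq _).1 hc)
    exact ⟨e, he.symm⟩
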